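/- arXiv:1003.1535 — 3 statements merged into one kernel-verified Lean document; each statement's English description precedes it below -/
import Mathlib

section
/- Let k ≥ 1 be an integer and let K be the kernel K(x) = a_k Σ_{j=k-1}^{2k+2} b_{j,k} x^{2j-2k+2} for x ∈ [-1,1], with a_k = (4k+5)!/(2^{4k+5}(2k)!(2k+2)!) and b_{j,k} = (-1)^{k+j+1}(2j)!/(j!(2k-j+2)!(2j-2k+2)!), and let K₃ denote the third derivative of this polynomial. Then for every integer j with 0 ≤ j ≤ 2k one has ∫_{-1}^{1} u^j K₃(u) du = 0. -/
open MeasureTheory ProbabilityTheory Filter Set Topology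

noncomputable section

/-- Normalising constant `a_k` of the kink-detection kernel. -/
def kinkA (k : ℕ) : ℝ :=
  (Nat.factorial (4*k+5) : ℝ) /
    (2^(4*k+5) * (Nat.factorial (2*k) : ℝ) * (Nat.factorial (2*k+2) : ℝ))

/-- Polynomial coefficients `b_{j,k}` of the kink-detection kernel. -/
def kinkB (j k : ℕ) : ℝ :=
  ((-1 : ℝ)^(k+j+1) * (Nat.factorial (2*j) : ℝ)) /
    ((Nat.factorial j : ℝ) * (Nat.factorial (2*k+2-j) : ℝ) *
      (Nat.factorial (2*j+2-2*k) : ℝ))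

/-- The polynomial part of the kernel `K ∈ 𝒦_{2k+1}`. -/
def kinkPoly (k : ℕ) : ℝ → ℝ := fun x =>
  kinkA k * ∑ j ∈ Finset.Icc (k-1) (2*k+2), kinkB j k * x ^ (2*j+2-2*k)

/-- `Kd k i` is the `i`-th derivative of the polynomial part of the kernel. -/
def Kd (k i : ℕ) : ℝ → ℝ := iteratedDeriv i (kinkPoly k)

/-- `Kde k i` is the `i`-th derivative of the polynomial part of the kernel,
extended by `0` outside `[-1,1]`. -/
def Kde (k i : ℕ) : ℝ → ℝ := fun x => if x ∈ Set.Icc (-1:ℝ) 1 then Kd k i x else 0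

/-- The smoothed third derivative `κ_h(t, μ) = h⁻⁴ ∫₀¹ K₃((x-t)/h) μ(x) dx`. -/
def kappah (k : ℕ) (h t : ℝ) (μ : ℝ → ℝ) : ℝ :=
  (h^4)⁻¹ * ∫ x in (0:ℝ)..1, Kde k 3 ((x - t)/h) * μ x

/-- The class `ℱ_s(λ)`: a kink of size `a_μ ≠ 0` in the first derivative at `λ`,
with `s`-smooth one-sided extensions whose derivatives of orders `2,…,s-1` match at `λ`. -/
def MemF (s : ℕ) (lam : ℝ) (μ : ℝ → ℝ) : Prop :=
  ∃ gm gp : ℝ → ℝ, ContDiff ℝ (s : ℕ∞) gm ∧ ContDiff ℝ (s : ℕ∞) gp ∧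
    (∀ x ≤ lam, μ x = gm x) ∧ (∀ x, lam ≤ x → μ x = gp x) ∧
    deriv gp lam - deriv gm lam ≠ 0 ∧
    ∀ i, 2 ≤ i → i ≤ s - 1 → iteratedDeriv i gp lam = iteratedDeriv i gm lam

/-- The no-kink class `𝒢_s`. -/
def MemG (s : ℕ) (μ : ℝ → ℝ) : Prop := ContDiff ℝ (s : ℕ∞) μ

/-- A slowly varying function. -/
def SlowlyVarying (L : ℝ → ℝ) : Prop :=
  (∀ x, 0 < x → 0 < L x) ∧
    ∀ c : ℝ, 0 < c → Tendsto (fun x : ℝ => L (c * x) / L x) atTop (𝓝 1)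

/-- Coefficients of the causal LRD linear process. -/
def lrdCoef (α : ℝ) (L : ℝ → ℝ) : ℕ → ℝ := fun i =>
  if i = 0 then 1 else (i : ℝ) ^ (-((1 + α) / 2)) * L i

/-- The filtration `ℱ_i = σ(…, η_{i-1}, η_i)` generated by the innovations. -/
def lrdFilt {Ω : Type*} [MeasurableSpace Ω] (η : ℤ → Ω → ℝ) (i : ℤ) : MeasurableSpace Ω :=
  ⨆ j : ℤ, ⨆ _ : j ≤ i, MeasurableSpace.comap (η j) (inferInstance : MeasurableSpace ℝ)

open Polynomial in
theorem iteratedDeriv_polynomial_eval (p : ℝ[X]) (n : ℕ) :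
    iteratedDeriv n (fun x => p.eval x) = fun x => (derivative^[n] p).eval x := by
  induction n with
  | zero => simp
  | succ n ih =>
    rw [iteratedDeriv_succ, ih, Function.iterate_succ_apply']
    funext x
    exact Polynomial.deriv _

open Polynomial in
theorem integral_eval_mul_iterate_derivative_eq_zero {a b : ℝ} {p q : ℝ[X]} {n m : ℕ} (hmn : m ≤ n)
    (ha : (X - C a) ^ n ∣ p) (hb : (X - C b) ^ n ∣ p) (hq : derivative^[m] q = 0) :
    ∫ x in a..b, q.eval x * (derivative^[m] p).eval x = 0 := by
  induction m generalizing q with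
  | zero => simp_all
  | succ m ih =>
    have root : ∀ c : ℝ, (X - C c) ^ n ∣ p → (derivative^[m] p).eval c = 0 := fun c hc =>
      dvd_iff_isRoot.1 <| (dvd_pow_self _ (by omega)).trans
        (pow_sub_dvd_iterate_derivative_of_pow_dvd m hc)
    rw [Function.iterate_succ_apply',
      intervalIntegral.integral_mul_deriv_eq_deriv_mul (fun x _ => q.hasDerivAt x)
        (fun x _ => (derivative^[m] p).hasDerivAt x)
        ((derivative q).continuous.intervalIntegrable _ _)
        ((derivative (derivative^[m] p)).continuous.intervalIntegrable _ _),
      root a ha, root b hb, ih (by omega) (by rwa [← Function.iterate_succ_apply])]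
    simp

open Polynomial in
theorem kinkPoly_eq_eval (n : ℕ) :
    kinkPoly (n + 1) = fun x => (C (kinkA (n + 1) * (-1) ^ n / (Nat.factorial (2 * n + 4) : ℝ)) *
      derivative^[2 * n] ((1 - X ^ 2 : ℝ[X]) ^ (2 * n + 4))).eval x := by
  have expand : (1 - X ^ 2 : ℝ[X]) ^ (2 * n + 4) = ∑ j ∈ Finset.range (2 * n + 5),
      C ((-1) ^ j * ((2 * n + 4).choose j : ℝ)) * X ^ (2 * j) := by
    rw [sub_eq_neg_add, add_pow]
    refine Finset.sum_congr rfl fun j _ => ?_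
    rw [neg_pow, pow_mul]
    simp
    ring
  funext x
  rw [expand, iterate_derivative_sum, eval_mul, eval_C, eval_finsetSum, kinkPoly, mul_div_assoc,
    mul_assoc, Finset.mul_sum (Finset.range _)]
  congr 1
  refine Finset.sum_subset_zero_on_sdiff (fun j hj => ?_) (fun j hj => ?_) (fun j hj => ?_)
  · simp at hj ⊢
    omega
  · have : 2 * j < 2 * n := by
      simp at hj
      omega
    rw [iterate_derivative_C_mul, iterate_derivative_X_pow_eq_C_mul,
      Nat.descFactorial_of_lt this]
    simp
  · obtain ⟨hj₁, hj₂⟩ := Finset.mem_Icc.1 hj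
    have hj₃ : j ≤ 2 * n + 4 := by omega
    have hd : ((2 * j - 2 * n).factorial : ℝ) * (2 * j).descFactorial (2 * n)
        = (2 * j).factorial := by
      exact_mod_cast Nat.factorial_mul_descFactorial (show 2 * n ≤ 2 * j by omega)
    rw [iterate_derivative_C_mul, iterate_derivative_X_pow_eq_C_mul, kinkB,
      show 2 * j + 2 - 2 * (n + 1) = 2 * j - 2 * n by omega,
      show 2 * (n + 1) + 2 - j = 2 * n + 4 - j by omega, Nat.cast_choose ℝ hj₃, ← hd]
    simp only [eval_mul, eval_C, eval_pow, eval_X]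
    field_simp
    ring

/-- vanishing moments of the third derivative of the kernel. -/
theorem kernel_vanishing_moments (k : ℕ) (hk : 1 ≤ k) (j : ℕ) (hj : j ≤ 2*k) :
    ∫ u in (-1:ℝ)..1, u ^ j * Kd k 3 u = 0 := by
  obtain ⟨n, rfl⟩ : ∃ n, k = n + 1 := ⟨k - 1, by omega⟩
  set c := kinkA (n + 1) * (-1) ^ n / (Nat.factorial (2 * n + 4) : ℝ)
  set p : Polynomial ℝ := Polynomial.C c * (1 - Polynomial.X ^ 2) ^ (2 * n + 4)
  have hK : Kd (n + 1) 3 = fun x => (Polynomial.derivative^[2 * n + 3] p).eval x := by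
    rw [Kd, kinkPoly_eq_eval, iteratedDeriv_polynomial_eval, ← Polynomial.iterate_derivative_C_mul,
      ← Function.iterate_add_apply, add_comm]
  have root : ∀ a : ℝ, a ^ 2 = 1 → (Polynomial.X - Polynomial.C a) ^ (2 * n + 4) ∣ p := by
    intro a ha
    refine Dvd.dvd.mul_left (pow_dvd_pow_of_dvd ?_ _) _
    rw [Polynomial.dvd_iff_isRoot]
    simp [ha]
  have hq : Polynomial.derivative^[2 * n + 3] (Polynomial.X ^ j : Polynomial ℝ) = 0 :=
    Polynomial.iterate_derivative_eq_zero (by rw [Polynomial.natDegree_X_pow]; omega)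
  simpa [hK] using integral_eval_mul_iterate_derivative_eq_zero (by omega)
    (root (-1) (by norm_num)) (root 1 (by norm_num)) hq

end
end

section
/- Let K ∈ 𝒦_s (s = 2k+1, k ≥ 1) with third derivative K₃, let m be an integer with 1 ≤ m ≤ 2k+1, and let g : [0,1] → ℝ be m times continuously differentiable. Then for every h ∈ (0,1) and t ∈ (h, 1-h), | h ∫_{-1}^{1} g(t + hu) K₃(u) du | ≤ (h^{m+1}/m!) sup_{x∈[0,1]} |g^{(m)}(x)| ∫_{-1}^{1} |u^m K₃(u)| du. In particular, for the random variable ζ₁(t) = σ(X₁) K₃((F(X₁) - t)/h) with X₁ having continuous strictly increasing cdf F and σ_F := σ ∘ F^{-1} m times continuously differentiable, |E ζ₁(t)| ≤ C h^{m+1} for a constant C independent of h and t. -/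
open MeasureTheory ProbabilityTheory Filter Set Topology

noncomputable section

open Polynomial in
/-- Repeated integration by parts on `[-1, 1]`: if the derivatives of `q` of order `< n` vanish at
`±1`, then `q^(n)` is orthogonal to the polynomials of degree `< n`. -/
theorem integral_mul_iterate_derivative_eq_zero (n : ℕ) (p q : ℝ[X])
    (hp : derivative^[n] p = 0)
    (h1 : ∀ i < n, (derivative^[i] q).eval 1 = 0)
    (h2 : ∀ i < n, (derivative^[i] q).eval (-1) = 0) :
    ∫ u in (-1 : ℝ)..1, p.eval u * (derivative^[n] q).eval u = 0 := by
  induction n generalizing p with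
  | zero =>
    have : p = 0 := hp
    simp [this]
  | succ n ih =>
    have hparts := intervalIntegral.integral_mul_deriv_eq_deriv_mul (a := -1) (b := 1)
      (u := fun x => p.eval x) (u' := fun x => (derivative p).eval x)
      (v := fun x => (derivative^[n] q).eval x)
      (v' := fun x => (derivative (derivative^[n] q)).eval x)
      (fun x _ => p.hasDerivAt x) (fun x _ => (derivative^[n] q).hasDerivAt x)
      ((Polynomial.continuous _).intervalIntegrable _ _)
      ((Polynomial.continuous _).intervalIntegrable _ _)
    rw [Function.iterate_succ_apply', hparts, h1 n n.lt_succ_self, h2 n n.lt_succ_self,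
      ih (derivative p) hp (fun i hi => h1 i (hi.trans n.lt_succ_self))
        (fun i hi => h2 i (hi.trans n.lt_succ_self))]
    ring

open Polynomial in
theorem iteratedDeriv_eval (n : ℕ) (p : ℝ[X]) :
    iteratedDeriv n (fun x => p.eval x) = fun x => (derivative^[n] p).eval x := by
  induction n with
  | zero => simp
  | succ n ih =>
    rw [iteratedDeriv_succ, ih, Function.iterate_succ_apply']
    ext x
    exact Polynomial.deriv _

open Polynomial in
/-- Rodrigues formula for the kernel. -/
theorem exists_kinkPoly_eq (k : ℕ) (hk : 1 ≤ k) :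
    ∃ c : ℝ, kinkPoly k = fun x =>
      (derivative^[2 * k - 2] (C c * (1 - X ^ 2) ^ (2 * k + 2) : ℝ[X])).eval x := by
  obtain ⟨l, rfl⟩ : ∃ l, k = l + 1 := ⟨k - 1, by omega⟩
  refine ⟨kinkA (l + 1) * (-1) ^ l / (Nat.factorial (2 * l + 4)), ?_⟩
  have hexp : ((1 - X ^ 2) ^ (2 * l + 4) : ℝ[X]) =
      ∑ j ∈ Finset.range (2 * l + 4 + 1),
        C ((-1) ^ j * (Nat.choose (2 * l + 4) j : ℝ)) * X ^ (2 * j) := by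
    rw [show (1 - X ^ 2 : ℝ[X]) = -X ^ 2 + 1 by ring, add_pow]
    refine Finset.sum_congr rfl fun j _ => ?_
    rw [neg_pow, ← pow_mul]
    simp only [map_mul, map_pow, map_neg, map_one, one_pow, map_natCast]
    ring
  ext x
  rw [show 2 * (l + 1) - 2 = 2 * l by omega, show 2 * (l + 1) + 2 = 2 * l + 4 by ring,
    iterate_derivative_C_mul, hexp, iterate_derivative_sum, eval_mul, eval_C, eval_finsetSum]
  simp only [iterate_derivative_C_mul, iterate_derivative_X_pow_eq_C_mul, eval_mul, eval_C,
    eval_pow, eval_X]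
  rw [kinkPoly, show 2 * (l + 1) + 2 = 2 * l + 4 by ring, show l + 1 - 1 = l by omega,
    mul_div_assoc, mul_assoc]
  congr 1
  rw [Finset.mul_sum]
  refine Finset.sum_subset_zero_on_sdiff ?_ ?_ ?_
  · intro j hj
    simp only [Finset.mem_Icc, Finset.mem_range] at hj ⊢
    omega
  · intro j hj
    simp only [Finset.mem_sdiff, Finset.mem_Icc, Finset.mem_range] at hj
    rw [Nat.descFactorial_of_lt (by omega : 2 * j < 2 * l)]
    simp
  · intro j hj
    rw [Finset.mem_Icc] at hj
    have hd := Nat.factorial_mul_descFactorial (by omega : 2 * l ≤ 2 * j)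
    have hc := Nat.choose_mul_factorial_mul_factorial hj.2
    rw [kinkB, show 2 * j + 2 - 2 * (l + 1) = 2 * j - 2 * l by omega,
      show 2 * (l + 1) + 2 - j = 2 * l + 4 - j by omega, ← hd, ← hc,
      show l + 1 + j + 1 = l + j + 2 by ring]
    have h1 : ((2 * j - 2 * l).factorial : ℝ) ≠ 0 := by positivity
    have h2 : (j.factorial : ℝ) ≠ 0 := by positivity
    have h3 : ((2 * l + 4 - j).factorial : ℝ) ≠ 0 := by positivity
    have h4 : ((Nat.choose (2 * l + 4) j : ℕ) : ℝ) ≠ 0 := by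
      exact_mod_cast (Nat.choose_pos hj.2).ne'
    push_cast
    field_simp
    ring

open Polynomial in
theorem exists_Kd_three_eq (k : ℕ) (hk : 1 ≤ k) :
    ∃ c : ℝ, Kd k 3 = fun x =>
      (derivative^[2 * k + 1] (C c * (1 - X ^ 2) ^ (2 * k + 2) : ℝ[X])).eval x := by
  obtain ⟨c, hc⟩ := exists_kinkPoly_eq k hk
  refine ⟨c, ?_⟩
  rw [Kd, hc, iteratedDeriv_eval, ← Function.iterate_add_apply,
    show 3 + (2 * k - 2) = 2 * k + 1 by omega]

theorem continuous_Kd_three (k : ℕ) (hk : 1 ≤ k) : Continuous (Kd k 3) := by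
  obtain ⟨c, hc⟩ := exists_Kd_three_eq k hk
  rw [hc]
  exact Polynomial.continuous _

open Polynomial in
/-- Vanishing moments of the third derivative of the kernel. -/
theorem integral_eval_mul_Kd_three (k : ℕ) (hk : 1 ≤ k) (p : ℝ[X])
    (hp : p.degree < ((2 * k + 1 : ℕ) : WithBot ℕ)) :
    ∫ u in (-1 : ℝ)..1, p.eval u * Kd k 3 u = 0 := by
  obtain ⟨c, hc⟩ := exists_Kd_three_eq k hk
  have hroot : ∀ a : ℝ, a ^ 2 = 1 → ∀ i < 2 * k + 1,
      (derivative^[i] (C c * (1 - X ^ 2) ^ (2 * k + 2) : ℝ[X])).eval a = 0 := by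
    intro a ha i hi
    rw [iterate_derivative_C_mul]
    obtain ⟨r, hr⟩ := dvd_trans (dvd_pow_self _ (by omega : 2 * k + 2 - i ≠ 0))
      (pow_sub_dvd_iterate_derivative_pow (1 - X ^ 2 : ℝ[X]) (2 * k + 2) i)
    simp [hr, ha]
  rw [hc]
  exact integral_mul_iterate_derivative_eq_zero _ p _
    (iterate_derivative_eq_zero_of_degree_lt hp)
    (hroot 1 (by norm_num)) (hroot (-1) (by norm_num))

open Polynomial in
/-- Taylor's theorem at `0` with a polynomial approximant independent of the evaluation point. -/
theorem exists_polynomial_abs_sub_le (m : ℕ) (hm : 1 ≤ m) (f : ℝ → ℝ)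
    (hf : ContDiff ℝ (m : ℕ∞) f) (S : ℝ) (hS : ∀ x ∈ Icc (-1 : ℝ) 1, |iteratedDeriv m f x| ≤ S) :
    ∃ p : ℝ[X], p.degree < (m : WithBot ℕ) ∧
      ∀ u ∈ Icc (-1 : ℝ) 1, |f u - p.eval u| ≤ S * |u| ^ m / m.factorial := by
  obtain ⟨n, rfl⟩ : ∃ n, m = n + 1 := ⟨m - 1, by omega⟩
  refine ⟨∑ i ∈ Finset.range (n + 1), C ((i.factorial : ℝ)⁻¹ * iteratedDeriv i f 0) * X ^ i,
    ?_, ?_⟩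
  · refine (degree_sum_le _ _).trans_lt ((Finset.sup_lt_iff (WithBot.bot_lt_coe _)).2 ?_)
    intro i hi
    exact (degree_C_mul_X_pow_le _ _).trans_lt (by exact_mod_cast Finset.mem_range.1 hi)
  · intro u hu
    rcases eq_or_ne (0 : ℝ) u with rfl | hu0
    · simp [Finset.sum_range_succ', eval_finsetSum]
    obtain ⟨y, hy, hyeq⟩ := taylor_mean_remainder_lagrange_iteratedDeriv (n := n) hu0
      (hf.contDiffOn (s := uIcc 0 u))
    have hpoly : taylorWithinEval f n (uIcc 0 u) 0 u = (∑ i ∈ Finset.range (n + 1),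
        C ((i.factorial : ℝ)⁻¹ * iteratedDeriv i f 0) * X ^ i).eval u := by
      rw [taylor_within_apply, eval_finsetSum]
      refine Finset.sum_congr rfl fun i hi => ?_
      rw [iteratedDerivWithin_eq_iteratedDeriv (uniqueDiffOn_uIcc hu0)
        ((hf.of_le (by exact_mod_cast (Finset.mem_range.1 hi).le)).contDiffAt) left_mem_uIcc]
      simp only [eval_mul, eval_C, eval_pow, eval_X, smul_eq_mul]
      ring
    have hy' : y ∈ Icc (-1 : ℝ) 1 :=
      uIcc_subset_Icc (by norm_num) hu (Ioo_subset_Icc_self hy)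
    rw [← hpoly, hyeq, sub_zero, abs_div, abs_mul, abs_pow, Nat.abs_cast]
    gcongr
    exact hS y hy'

theorem le_biSup_Icc_of_continuous (f : ℝ → ℝ) (hf : Continuous f) (x : ℝ)
    (hx : x ∈ Icc (0 : ℝ) 1) : |f x| ≤ ⨆ y ∈ Icc (0 : ℝ) 1, |f y| := by
  obtain ⟨B, hB⟩ := (isCompact_Icc (a := (0 : ℝ)) (b := 1)).bddAbove_image hf.abs.continuousOn
  refine le_ciSup₂ (f := fun y (_ : y ∈ Icc (0 : ℝ) 1) => |f y|) ⟨B, ?_⟩ x hx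
  rintro z hz
  obtain ⟨y, hy, rfl⟩ := mem_iUnion.1 hz
  exact hB (mem_image_of_mem _ hy)

theorem abs_mul_integral_mul_Kd_three_le (k m : ℕ) (hk : 1 ≤ k) (hm1 : 1 ≤ m)
    (hm2 : m ≤ 2 * k + 1) (g : ℝ → ℝ) (hg : ContDiff ℝ (m : ℕ∞) g) (h : ℝ)
    (hh : h ∈ Ioo (0 : ℝ) 1) (t : ℝ) (ht : t ∈ Ioo h (1 - h)) :
    |h * ∫ u in (-1 : ℝ)..1, g (t + h * u) * Kd k 3 u| ≤
      (h ^ (m + 1) / (Nat.factorial m : ℝ)) *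
        (⨆ x ∈ Icc (0 : ℝ) 1, |iteratedDeriv m g x|) *
        ∫ u in (-1 : ℝ)..1, |u ^ m * Kd k 3 u| := by
  have hh0 := hh.1
  set S := ⨆ x ∈ Icc (0 : ℝ) 1, |iteratedDeriv m g x|
  have hgm : Continuous (iteratedDeriv m g) := hg.continuous_iteratedDeriv m le_rfl
  have hf : ContDiff ℝ (m : ℕ∞) fun u => g (t + h * u) := by fun_prop
  have hderiv : ∀ x, iteratedDeriv m (fun u => g (t + h * u)) x =
      h ^ m * iteratedDeriv m g (t + h * x) := by
    intro x
    have hc : ContDiff ℝ m fun v => g (t + v) := by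
      exact hg.comp (contDiff_const.add contDiff_id)
    have := congrFun (iteratedDeriv_comp_const_mul hc h) x
    rw [iteratedDeriv_comp_const_add] at this
    exact this
  have hmem : ∀ x ∈ Icc (-1 : ℝ) 1, t + h * x ∈ Icc (0 : ℝ) 1 := by
    intro x hx
    have h1 := ht.1
    have h2 := ht.2
    constructor <;> nlinarith [hx.1, hx.2]
  obtain ⟨p, hpdeg, hp⟩ := exists_polynomial_abs_sub_le m hm1 _ hf (h ^ m * S) (by
    intro x hx
    rw [hderiv, abs_mul, abs_of_nonneg (by positivity : 0 ≤ h ^ m)]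
    gcongr
    exact le_biSup_Icc_of_continuous _ hgm _ (hmem x hx))
  have hK := continuous_Kd_three k hk
  have hgc : Continuous fun u => g (t + h * u) := hf.continuous
  have hpc := p.continuous
  have hsub : ∫ u in (-1 : ℝ)..1, g (t + h * u) * Kd k 3 u =
      ∫ u in (-1 : ℝ)..1, (g (t + h * u) - p.eval u) * Kd k 3 u := by
    simp only [sub_mul]
    have hi1 : IntervalIntegrable (fun u => g (t + h * u) * Kd k 3 u) volume (-1) 1 :=
      (hgc.mul hK).intervalIntegrable _ _
    have hi2 : IntervalIntegrable (fun u => p.eval u * Kd k 3 u) volume (-1) 1 :=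
      (hpc.mul hK).intervalIntegrable _ _
    rw [intervalIntegral.integral_sub hi1 hi2, integral_eval_mul_Kd_three k hk p
      (hpdeg.trans_le (by exact_mod_cast hm2)), sub_zero]
  have hbound : |∫ u in (-1 : ℝ)..1, (g (t + h * u) - p.eval u) * Kd k 3 u| ≤
      ∫ u in (-1 : ℝ)..1, (h ^ m * S / m.factorial) * |u ^ m * Kd k 3 u| := by
    refine (intervalIntegral.abs_integral_le_integral_abs (by norm_num)).trans ?_
    refine intervalIntegral.integral_mono_on (by norm_num)
      (Continuous.intervalIntegrable (by fun_prop) _ _)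
      (Continuous.intervalIntegrable (by fun_prop) _ _) fun u hu => ?_
    rw [abs_mul, abs_mul, abs_pow, ← mul_assoc]
    gcongr
    refine (hp u hu).trans_eq (by ring)
  rw [intervalIntegral.integral_const_mul] at hbound
  rw [abs_mul, abs_of_pos hh0, hsub]
  calc _ ≤ h * _ := mul_le_mul_of_nonneg_left hbound hh0.le
    _ = _ := by ring

/-- Probability integral transform for a continuous, strictly increasing distribution function. -/
theorem map_cdf_eq_volume_restrict_Icc (μ : Measure ℝ) [IsProbabilityMeasure μ]
    (hc : Continuous (cdf μ)) (hm : StrictMono (cdf μ)) :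
    μ.map (cdf μ) = volume.restrict (Icc (0 : ℝ) 1) := by
  have hlt : ∀ x, cdf μ x < 1 := fun x => (hm (lt_add_one x)).trans_le (cdf_le_one μ _)
  have hpos : ∀ x, 0 < cdf μ x := fun x => (cdf_nonneg μ _).trans_lt (hm (sub_one_lt x))
  have : IsProbabilityMeasure (μ.map (cdf μ)) :=
    Measure.isProbabilityMeasure_map hc.measurable.aemeasurable
  refine Measure.ext_of_Iic _ _ fun y => ?_
  rw [Measure.map_apply hc.measurable measurableSet_Iic, Measure.restrict_apply measurableSet_Iic]
  rcases le_or_gt y 0 with hy0 | hy0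
  · have h1 : cdf μ ⁻¹' Iic y = ∅ := by
      ext x
      simpa using hy0.trans_lt (hpos x)
    have h2 : Iic y ∩ Icc (0 : ℝ) 1 ⊆ {0} := fun x hx =>
      le_antisymm (hx.1.trans hy0) hx.2.1
    rw [h1, measure_empty, measure_mono_null h2 Real.volume_singleton]
  rcases le_or_gt 1 y with hy1 | hy1
  · have h1 : cdf μ ⁻¹' Iic y = univ := by
      ext x
      simpa using (hlt x).le.trans hy1
    have h2 : Iic y ∩ Icc (0 : ℝ) 1 = Icc 0 1 := inter_eq_right.2 fun x hx => hx.2.trans hy1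
    rw [h1, h2, measure_univ, Real.volume_Icc]
    simp
  obtain ⟨x, rfl⟩ : y ∈ range (cdf μ) := mem_range_of_exists_le_of_exists_ge hc
    (((tendsto_cdf_atBot μ).eventually_le_const hy0).exists)
    (((tendsto_cdf_atTop μ).eventually_const_le hy1).exists)
  have h1 : cdf μ ⁻¹' Iic (cdf μ x) = Iic x := by
    ext z
    exact hm.le_iff_le
  have h2 : Iic (cdf μ x) ∩ Icc (0 : ℝ) 1 = Icc 0 (cdf μ x) := by
    ext z
    simp only [mem_inter_iff, mem_Iic, mem_Icc]
    exact ⟨fun hz => ⟨hz.2.1, hz.1⟩, fun hz => ⟨hz.2, hz.1, hz.2.trans hy1.le⟩⟩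
  rw [h1, h2, Real.volume_Icc, sub_zero, ofReal_cdf]

theorem integral_Icc_mul_Kde_three (k : ℕ) (f : ℝ → ℝ) (h : ℝ) (hh : 0 < h) (t : ℝ)
    (ht : t ∈ Ioo h (1 - h)) :
    ∫ y in Icc (0 : ℝ) 1, f y * Kde k 3 ((y - t) / h) =
      h * ∫ u in (-1 : ℝ)..1, f (t + h * u) * Kd k 3 u := by
  have hiff : ∀ y, (y - t) / h ∈ Icc (-1 : ℝ) 1 ↔ y ∈ Icc (t - h) (t + h) := by
    intro y
    rw [mem_Icc, mem_Icc, le_div_iff₀ hh, div_le_iff₀ hh]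
    constructor <;> rintro ⟨h1, h2⟩ <;> constructor <;> linarith
  have hsub : Icc (t - h) (t + h) ⊆ Icc (0 : ℝ) 1 :=
    Icc_subset_Icc (by linarith [ht.1]) (by linarith [ht.2])
  rw [setIntegral_eq_of_subset_of_forall_sdiff_eq_zero measurableSet_Icc hsub (by
    intro y hy
    rw [Kde, if_neg (mt (hiff y).1 hy.2), mul_zero])]
  have hK : ∫ y in Icc (t - h) (t + h), f y * Kde k 3 ((y - t) / h) =
      ∫ y in Icc (t - h) (t + h), f y * Kd k 3 ((y - t) / h) :=
    setIntegral_congr_fun measurableSet_Icc fun y hy => by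
      simp only [Kde, if_pos ((hiff y).2 hy)]
  rw [hK, integral_Icc_eq_integral_Ioc, ← intervalIntegral.integral_of_le (by linarith)]
  have hcov := intervalIntegral.smul_integral_comp_add_mul (a := -1) (b := 1)
    (fun y => f y * Kd k 3 ((y - t) / h)) h t
  rw [show t + h * (-1) = t - h by ring, mul_one] at hcov
  rw [← hcov, smul_eq_mul]
  simp only [add_sub_cancel_left, mul_div_cancel_left₀ _ hh.ne']

theorem measurable_Kde_three (k : ℕ) (hk : 1 ≤ k) : Measurable (Kde k 3) :=
  Measurable.ite measurableSet_Icc (continuous_Kd_three k hk).measurable measurable_const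

/-- moment bound for smooth functions against `K₃`, and bound on `E ζ₁(t)`. -/
theorem kernel_moment_bound (k m : ℕ) (hk : 1 ≤ k) (hm1 : 1 ≤ m) (hm2 : m ≤ 2*k+1)
    (g : ℝ → ℝ) (hg : ContDiff ℝ (m : ℕ∞) g)
    {Ω : Type*} [MeasurableSpace Ω] (P : Measure Ω) [IsProbabilityMeasure P]
    (X : Ω → ℝ) (hX : Measurable X)
    (F Q : ℝ → ℝ)
    (hF : ∀ x, F x = ((P.map X) (Set.Iic x)).toReal)
    (hFc : Continuous F) (hFm : StrictMono F)
    (hQ : ∀ x, Q (F x) = x)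
    (σf : ℝ → ℝ) (hσm : Measurable σf) (hσb : ∃ M, ∀ x, |σf x| ≤ M)
    (hσF : ContDiff ℝ (m : ℕ∞) (fun x => σf (Q x))) :
    (∀ h ∈ Set.Ioo (0:ℝ) 1, ∀ t ∈ Set.Ioo h (1-h),
      |h * ∫ u in (-1:ℝ)..1, g (t + h*u) * Kd k 3 u| ≤
        (h^(m+1) / (Nat.factorial m : ℝ)) *
          (⨆ x ∈ Set.Icc (0:ℝ) 1, |iteratedDeriv m g x|) *
          ∫ u in (-1:ℝ)..1, |u^m * Kd k 3 u|) ∧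
    ∃ C : ℝ, 0 < C ∧ ∀ h ∈ Set.Ioo (0:ℝ) 1, ∀ t ∈ Set.Ioo h (1-h),
      |∫ ω, σf (X ω) * Kde k 3 ((F (X ω) - t)/h) ∂P| ≤ C * h^(m+1) := by
  refine ⟨fun h hh t ht => abs_mul_integral_mul_Kd_three_le k m hk hm1 hm2 g hg h hh t ht, ?_⟩
  have : IsProbabilityMeasure (P.map X) := Measure.isProbabilityMeasure_map hX.aemeasurable
  have hcdf : F = cdf (P.map X) := by
    ext x
    rw [hF, cdf_eq_real, measureReal_def]
  have hlaw : P.map (fun ω => F (X ω)) = volume.restrict (Icc (0 : ℝ) 1) := by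
    rw [hcdf] at hFc hFm
    rw [← map_cdf_eq_volume_restrict_Icc (P.map X) hFc hFm, ← hcdf]
    exact (Measure.map_map (hcdf ▸ hFc.measurable) hX).symm
  set B := (⨆ x ∈ Icc (0 : ℝ) 1, |iteratedDeriv m (fun x => σf (Q x)) x|) *
    ∫ u in (-1 : ℝ)..1, |u ^ m * Kd k 3 u|
  refine ⟨|B| / m.factorial + 1, by positivity, fun h hh t ht => ?_⟩
  have hmeas : Measurable fun y => σf (Q y) * Kde k 3 ((y - t) / h) :=
    hσF.continuous.measurable.mul ((measurable_Kde_three k hk).comp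
      ((measurable_id.sub_const t).div_const h))
  have hFX : Measurable fun ω => F (X ω) := hFc.measurable.comp hX
  have hexp : ∫ ω, σf (X ω) * Kde k 3 ((F (X ω) - t) / h) ∂P =
      h * ∫ u in (-1 : ℝ)..1, σf (Q (t + h * u)) * Kd k 3 u := by
    rw [← integral_Icc_mul_Kde_three k (fun y => σf (Q y)) h hh.1 t ht, ← hlaw,
      integral_map hFX.aemeasurable hmeas.aestronglyMeasurable]
    simp only [hQ]
  rw [hexp]
  have hpow : 0 < h ^ (m + 1) := pow_pos hh.1 _
  calc _ ≤ _ := abs_mul_integral_mul_Kd_three_le k m hk hm1 hm2 _ hσF h hh t ht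
    _ = B / m.factorial * h ^ (m + 1) := by ring
    _ ≤ (|B| / m.factorial + 1) * h ^ (m + 1) := by
      gcongr
      exact (div_le_div_of_nonneg_right (le_abs_self B) (by positivity)).trans (by linarith)

end
end

section
/- Let X₁ be a real random variable with continuous strictly increasing cdf F and quantile function Q = F^{-1}, let μ and σ be bounded measurable functions with μ_F := μ∘Q and σ_F := σ∘Q continuous at a fixed point t ∈ (0,1), and let K ∈ 𝒦_s with third derivative K₃. Define ζ₁(t) = σ(X₁) K₃((F(X₁) - t)/h) and γ₁(t) = μ(X₁) K₃((F(X₁) - t)/h). Then as h → 0, h^{-1}( Var ζ₁(t) + Var γ₁(t) ) → (σ_F²(t) + μ_F²(t)) ∫_{-1}^{1} K₃²(x) dx. -/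
open MeasureTheory ProbabilityTheory Filter Set Topology

noncomputable section

lemma continuous_Kd (k i : ℕ) : Continuous (Kd k i) := by
  have h : ContDiff ℝ i (kinkPoly k) := by
    unfold kinkPoly
    fun_prop
  exact h.continuous_iteratedDeriv i le_rfl

lemma Kde_eq_indicator (k i : ℕ) :
    Kde k i = (Set.Icc (-1 : ℝ) 1).indicator (Kd k i) := by
  ext x
  simp [Kde, Set.indicator_apply]

lemma measurable_Kde (k i : ℕ) : Measurable (Kde k i) := by
  rw [Kde_eq_indicator]
  exact (continuous_Kd k i).measurable.indicator measurableSet_Icc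

lemma exists_bound_Kde (k i : ℕ) : ∃ C, ∀ x, |Kde k i x| ≤ C := by
  obtain ⟨C, hC⟩ := (isCompact_Icc (a := (-1 : ℝ)) (b := 1)).exists_bound_of_continuousOn
    (continuous_Kd k i).continuousOn
  refine ⟨max C 0, fun x => ?_⟩
  unfold Kde
  split_ifs with h
  · exact (hC x h).trans (le_max_left _ _)
  · simp

lemma Kde_pow_eq_indicator (k i : ℕ) {n : ℕ} (hn : n ≠ 0) :
    (fun x => Kde k i x ^ n) = (Set.Icc (-1 : ℝ) 1).indicator (fun x => Kd k i x ^ n) := by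
  ext x
  by_cases h : x ∈ Set.Icc (-1 : ℝ) 1
  · rw [Set.indicator_of_mem h, Kde, if_pos h]
  · rw [Set.indicator_of_notMem h, Kde, if_neg h, zero_pow hn]

lemma integrable_Kde_pow (k i : ℕ) {n : ℕ} (hn : n ≠ 0) :
    Integrable (fun x => Kde k i x ^ n) := by
  rw [Kde_pow_eq_indicator k i hn, integrable_indicator_iff measurableSet_Icc]
  exact ((continuous_Kd k i).pow n).continuousOn.integrableOn_Icc

lemma integral_Kde_pow (k i : ℕ) {n : ℕ} (hn : n ≠ 0) :
    ∫ x, Kde k i x ^ n = ∫ x in (-1 : ℝ)..1, Kd k i x ^ n := by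
  rw [Kde_pow_eq_indicator k i hn, integral_indicator measurableSet_Icc,
    intervalIntegral.integral_of_le (by norm_num), integral_Icc_eq_integral_Ioc]

/-- The probability integral transform: a continuous strictly increasing cdf
maps its law to the uniform distribution. -/
lemma map_cdf_eq_uniform {ν : Measure ℝ} [IsProbabilityMeasure ν] {F Q : ℝ → ℝ}
    (hF : ∀ x, F x = (ν (Set.Iic x)).toReal) (hFm : StrictMono F)
    (hFQ : ∀ p ∈ Set.Ioo (0 : ℝ) 1, F (Q p) = p) :
    ν.map F = volume.restrict (Set.Ioo (0 : ℝ) 1) := by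
  have h0 : ∀ x, 0 < F x := fun x =>
    lt_of_le_of_lt (by rw [hF]; exact ENNReal.toReal_nonneg) (hFm (sub_one_lt x))
  have h1 : ∀ x, F x < 1 := fun x =>
    (hFm (lt_add_one x)).trans_le (by rw [hF]; exact measureReal_le_one)
  have : IsProbabilityMeasure (ν.map F) :=
    Measure.isProbabilityMeasure_map hFm.monotone.measurable.aemeasurable
  refine Measure.ext_of_Iic _ _ fun a => ?_
  rw [Measure.map_apply hFm.monotone.measurable measurableSet_Iic,
    Measure.restrict_apply measurableSet_Iic]
  rcases le_or_gt a 0 with ha | ha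
  · have e1 : F ⁻¹' Set.Iic a = ∅ := by
      ext x
      simpa using ha.trans_lt (h0 x)
    have e2 : Set.Iic a ∩ Set.Ioo (0 : ℝ) 1 = ∅ := by
      ext x
      simp only [Set.mem_inter_iff, Set.mem_Iic, Set.mem_Ioo, Set.mem_empty_iff_false]
      grind
    rw [e1, e2, measure_empty, measure_empty]
  rcases le_or_gt 1 a with ha' | ha'
  · have e1 : F ⁻¹' Set.Iic a = Set.univ := by
      ext x
      simpa using (h1 x).le.trans ha'
    have e2 : Set.Iic a ∩ Set.Ioo (0 : ℝ) 1 = Set.Ioo 0 1 := by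
      ext x
      simp only [Set.mem_inter_iff, Set.mem_Iic, Set.mem_Ioo]
      grind
    rw [e1, e2, measure_univ, Real.volume_Ioo]
    simp
  · have e1 : F ⁻¹' Set.Iic a = Set.Iic (Q a) := by
      ext x
      rw [Set.mem_preimage, Set.mem_Iic, Set.mem_Iic, ← hFm.le_iff_le (a := x), hFQ a ⟨ha, ha'⟩]
    have e2 : Set.Iic a ∩ Set.Ioo (0 : ℝ) 1 = Set.Ioc 0 a := by
      ext x
      simp only [Set.mem_inter_iff, Set.mem_Iic, Set.mem_Ioo, Set.mem_Ioc]
      grind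
    rw [e1, e2, Real.volume_Ioc, sub_zero, ← ENNReal.ofReal_toReal (measure_ne_top ν _), ← hF,
      hFQ a ⟨ha, ha'⟩]

lemma MonotoneOn.measurable_indicator_comp {Q m : ℝ → ℝ} {s : Set ℝ} (hs : MeasurableSet s)
    (hQ : MonotoneOn Q s) (hm : Measurable m) : Measurable (s.indicator (m ∘ Q)) := by
  have hr : Measurable (s.domRestrict Q) :=
    Monotone.measurable fun x y hxy => hQ x.2 y.2 hxy
  refine measurable_of_restrict_of_restrict_compl hs ?_ ?_
  · convert hm.comp hr using 1
    ext x
    exact Set.indicator_of_mem x.2 _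
  · convert measurable_const (a := (0 : ℝ)) using 1
    ext x
    exact Set.indicator_of_notMem x.2 _

/-- Convolution with a rescaled integrable kernel localises at a continuity point. -/
lemma tendsto_integral_rescaled_kernel {G ψ : ℝ → ℝ} {t C : ℝ} (hGm : Measurable G)
    (hGb : ∀ x, |G x| ≤ C) (hGc : ContinuousAt G t) (hψ : Integrable ψ) :
    Tendsto (fun h : ℝ => (∫ u, G u * ψ ((u - t) / h)) / h) (𝓝[>] 0)
      (𝓝 (G t * ∫ x, ψ x)) := by
  have hscale : ∀ h : ℝ, 0 < h →
      ∫ x, G (t + h * x) * ψ x = (∫ u, G u * ψ ((u - t) / h)) / h := by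
    intro h hh
    have e1 := Measure.integral_comp_mul_left (fun y => G (t + y) * ψ (y / h)) h
    have e2 := integral_add_left_eq_self (μ := volume) (fun u => G u * ψ ((u - t) / h)) t
    simp only [add_sub_cancel_left] at e2
    rw [e2, abs_of_pos (inv_pos.mpr hh), smul_eq_mul] at e1
    rw [div_eq_inv_mul, ← e1]
    simp only [mul_div_cancel_left₀ _ hh.ne']
  have key : Tendsto (fun h : ℝ => ∫ x, G (t + h * x) * ψ x) (𝓝[>] 0)
      (𝓝 (∫ x, G t * ψ x)) := by
    refine tendsto_integral_filter_of_dominated_convergence (fun x => C * |ψ x|) ?_ ?_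
      (hψ.abs.const_mul C) ?_
    · refine Eventually.of_forall fun h => ?_
      exact (hGm.comp (by fun_prop)).aestronglyMeasurable.mul hψ.aestronglyMeasurable
    · refine Eventually.of_forall fun h => Eventually.of_forall fun x => ?_
      rw [Real.norm_eq_abs, abs_mul]
      exact mul_le_mul_of_nonneg_right (hGb _) (abs_nonneg _)
    · refine Eventually.of_forall fun x => Tendsto.mul_const _ ?_
      have : Tendsto (fun h : ℝ => t + h * x) (𝓝[>] 0) (𝓝 t) := by
        have hc : Continuous fun h : ℝ => t + h * x := by fun_prop
        simpa using (hc.tendsto 0).mono_left nhdsWithin_le_nhds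
      exact hGc.tendsto.comp this
  rw [integral_const_mul] at key
  refine key.congr' ?_
  filter_upwards [self_mem_nhdsWithin] with h hh using hscale h hh

/-- The moments of the kernel statistic are, after division by `h`, asymptotically
those of the kernel. -/
lemma tendsto_moment_div {Ω : Type*} [MeasurableSpace Ω] {P : Measure Ω} {U : Ω → ℝ}
    (hUm : Measurable U) (hU : P.map U = volume.restrict (Set.Ioo (0 : ℝ) 1)) {g : ℝ → ℝ} {t C : ℝ}
    (hgm : Measurable ((Set.Ioo (0 : ℝ) 1).indicator g))
    (hgb : ∀ x, |g x| ≤ C) (ht : t ∈ Set.Ioo (0 : ℝ) 1)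
    (hgc : ContinuousAt g t) (k i : ℕ) {n : ℕ} (hn : n ≠ 0) :
    Tendsto (fun h : ℝ => (∫ ω, (g (U ω) * Kde k i ((U ω - t) / h)) ^ n ∂P) / h) (𝓝[>] 0)
      (𝓝 (g t ^ n * ∫ x in (-1 : ℝ)..1, Kd k i x ^ n)) := by
  set G := (Set.Ioo (0 : ℝ) 1).indicator g with hG
  have hGt : G t = g t := Set.indicator_of_mem ht g
  have hGg : G =ᶠ[𝓝 t] g := by
    filter_upwards [isOpen_Ioo.mem_nhds ht] with x hx using Set.indicator_of_mem hx g
  have hGc : ContinuousAt G t := hgc.congr hGg.symm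
  have hGb : ∀ x, |G x| ≤ C := fun x =>
    (norm_indicator_le_norm_self g x).trans (hgb x)
  have hUI : ∀ᵐ ω ∂P, U ω ∈ Set.Ioo (0 : ℝ) 1 := by
    refine ae_of_ae_map hUm.aemeasurable ?_
    rw [hU]
    exact ae_restrict_mem measurableSet_Ioo
  have hlim := tendsto_integral_rescaled_kernel (G := fun x => G x ^ n)
    (C := C ^ n) (hgm.pow_const n)
    (fun x => by rw [abs_pow]; exact pow_le_pow_left₀ (abs_nonneg _) (hGb x) n)
    (hGc.pow n) (integrable_Kde_pow k i hn)
  rw [hGt, integral_Kde_pow k i hn] at hlim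
  refine hlim.congr fun h => ?_
  congr 1
  have hm : Measurable fun u => (G u * Kde k i ((u - t) / h)) ^ n :=
    (hgm.mul ((measurable_Kde k i).comp (by fun_prop))).pow_const n
  calc ∫ u, G u ^ n * Kde k i ((u - t) / h) ^ n
      = ∫ u in Set.Ioo (0 : ℝ) 1, (G u * Kde k i ((u - t) / h)) ^ n := by
        simp only [← mul_pow]
        refine (setIntegral_eq_integral_of_forall_compl_eq_zero fun u hu => ?_).symm
        rw [hG, Set.indicator_of_notMem hu, zero_mul, zero_pow hn]
    _ = ∫ ω, (G (U ω) * Kde k i ((U ω - t) / h)) ^ n ∂P := by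
        rw [← hU, integral_map hUm.aemeasurable hm.aestronglyMeasurable]
    _ = ∫ ω, (g (U ω) * Kde k i ((U ω - t) / h)) ^ n ∂P := by
        refine integral_congr_ae ?_
        filter_upwards [hUI] with ω hω
        rw [hG, Set.indicator_of_mem hω]

lemma tendsto_variance_div {Ω : Type*} [MeasurableSpace Ω] {P : Measure Ω}
    [IsProbabilityMeasure P] {X : Ω → ℝ} (hX : Measurable X) {F Q : ℝ → ℝ}
    (hF : ∀ x, F x = ((P.map X) (Set.Iic x)).toReal) (hFm : StrictMono F)
    (hQ : ∀ x, Q (F x) = x) (hFQ : ∀ p ∈ Set.Ioo (0 : ℝ) 1, F (Q p) = p)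
    {m : ℝ → ℝ} (hmm : Measurable m) (hmb : ∃ M, ∀ x, |m x| ≤ M)
    {t : ℝ} (ht : t ∈ Set.Ioo (0 : ℝ) 1) (hmc : ContinuousAt (fun x => m (Q x)) t) (k i : ℕ) :
    Tendsto (fun h : ℝ => variance (fun ω => m (X ω) * Kde k i ((F (X ω) - t) / h)) P / h)
      (𝓝[>] 0) (𝓝 (m (Q t) ^ 2 * ∫ x in (-1 : ℝ)..1, Kd k i x ^ 2)) := by
  obtain ⟨M, hM⟩ := hmb
  obtain ⟨C, hC⟩ := exists_bound_Kde k i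
  have hFmeas : Measurable F := hFm.monotone.measurable
  have : IsProbabilityMeasure (P.map X) := Measure.isProbabilityMeasure_map hX.aemeasurable
  have hU : P.map (F ∘ X) = volume.restrict (Set.Ioo (0 : ℝ) 1) := by
    rw [← Measure.map_map hFmeas hX, map_cdf_eq_uniform hF hFm hFQ]
  have hQm : MonotoneOn Q (Set.Ioo (0 : ℝ) 1) := fun x hx y hy hxy => by
    rwa [← hFm.le_iff_le, hFQ x hx, hFQ y hy]
  have hmom := fun {n : ℕ} (hn : n ≠ 0) => tendsto_moment_div (hFmeas.comp hX) hU
    (hQm.measurable_indicator_comp measurableSet_Ioo hmm) (fun x => hM (Q x)) ht hmc k i hn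
  simp only [Function.comp_apply, hQ] at hmom
  have h1 := hmom one_ne_zero
  have h2 := hmom two_ne_zero
  have hid : Tendsto (fun h : ℝ => h) (𝓝[>] 0) (𝓝 0) := nhdsWithin_le_nhds
  have hlim := h2.sub (hid.mul (h1.pow 2))
  rw [zero_mul, sub_zero] at hlim
  refine hlim.congr' ?_
  filter_upwards [self_mem_nhdsWithin] with h hh
  have hh' : h ≠ 0 := (Set.mem_Ioi.mp hh).ne'
  have hmeas : Measurable fun ω => m (X ω) * Kde k i ((F (X ω) - t) / h) :=
    (hmm.comp hX).mul ((measurable_Kde k i).comp (((hFmeas.comp hX).sub_const t).div_const h))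
  have hLp : MemLp (fun ω => m (X ω) * Kde k i ((F (X ω) - t) / h)) 2 P := by
    refine MemLp.of_bound hmeas.aestronglyMeasurable (M * C) (Eventually.of_forall fun ω => ?_)
    rw [Real.norm_eq_abs, abs_mul]
    exact mul_le_mul (hM _) (hC _) (abs_nonneg _) ((abs_nonneg _).trans (hM 0))
  rw [variance_eq_sub hLp]
  simp only [pow_one, Pi.pow_apply]
  field_simp

/-- asymptotic variance of the kernel statistics as `h → 0⁺`. -/
theorem kernel_variance_limit (k : ℕ) (hk : 1 ≤ k)
    {Ω : Type*} [MeasurableSpace Ω] (P : Measure Ω) [IsProbabilityMeasure P]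
    (X : Ω → ℝ) (hX : Measurable X)
    (F Q : ℝ → ℝ)
    (hF : ∀ x, F x = ((P.map X) (Set.Iic x)).toReal)
    (hFc : Continuous F) (hFm : StrictMono F)
    (hQ : ∀ x, Q (F x) = x) (hFQ : ∀ p ∈ Set.Ioo (0:ℝ) 1, F (Q p) = p)
    (μ σf : ℝ → ℝ) (hμm : Measurable μ) (hμb : ∃ M, ∀ x, |μ x| ≤ M)
    (hσm : Measurable σf) (hσb : ∃ M, ∀ x, |σf x| ≤ M)
    (t : ℝ) (ht : t ∈ Set.Ioo (0:ℝ) 1)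
    (hμc : ContinuousAt (fun x => μ (Q x)) t) (hσc : ContinuousAt (fun x => σf (Q x)) t) :
    Tendsto (fun h : ℝ =>
        (variance (fun ω => σf (X ω) * Kde k 3 ((F (X ω) - t)/h)) P +
            variance (fun ω => μ (X ω) * Kde k 3 ((F (X ω) - t)/h)) P) / h)
      (𝓝[>] 0)
      (𝓝 (((σf (Q t))^2 + (μ (Q t))^2) * ∫ x in (-1:ℝ)..1, (Kd k 3 x)^2)) := by
  refine ((tendsto_variance_div hX hF hFm hQ hFQ hσm hσb ht hσc k 3).add
    (tendsto_variance_div hX hF hFm hQ hFQ hμm hμb ht hμc k 3)).congr (fun h => ?_) |>.trans ?_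
  · rw [add_div]
  · rw [add_mul]

end
end
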